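/- If f is a harmonic mapping in the unit disk D with finite Bloch number β_f = sup_{z ∈ D} (1−|z|²) Λ_f(z), then ‖f‖_{BMO_2} ≤ β_f. -/

import Mathlib

open Complex MeasureTheory Metric Set Real
open scoped ENNReal

/-- The Wirtinger derivative `f_z = (f_x - i f_y)/2` of `f` at `z`
(real Fréchet derivative applied to the directions `1` and `i`). -/
noncomputable def wirtingerZ (f : ℂ → ℂ) (z : ℂ) : ℂ :=
  (fderiv ℝ f z 1 - Complex.I * fderiv ℝ f z Complex.I) / 2

/-- The Wirtinger derivative `f_z̄ = (f_x + i f_y)/2` of `f` at `z`. -/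
noncomputable def wirtingerZbar (f : ℂ → ℂ) (z : ℂ) : ℂ :=
  (fderiv ℝ f z 1 + Complex.I * fderiv ℝ f z Complex.I) / 2

/-- `Λ_f(z) = |f_z(z)| + |f_z̄(z)|`. -/
noncomputable def Lam (f : ℂ → ℂ) (z : ℂ) : ℝ :=
  ‖wirtingerZ f z‖ + ‖wirtingerZbar f z‖

/-- A complex-valued function is harmonic on a set: it is `C²` there and its
Laplacian `f_xx + f_yy` vanishes (equivalently, its real and imaginary parts are
real harmonic). -/
def IsHarmonicOn (f : ℂ → ℂ) (s : Set ℂ) : Prop :=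
  ContDiffOn ℝ 2 f s ∧ ∀ z ∈ s,
    fderiv ℝ (fun w => fderiv ℝ f w 1) z 1
      + fderiv ℝ (fun w => fderiv ℝ f w Complex.I) z Complex.I = 0

/-- A majorant: a continuous increasing function `ω : [0,∞) → [0,∞)` with
`ω 0 = 0` such that `ω t / t` is non-increasing for `t > 0`. -/
def IsMajorant (ω : ℝ → ℝ) : Prop :=
  ContinuousOn ω (Ici 0) ∧ MonotoneOn ω (Ici 0) ∧ ω 0 = 0 ∧
    ∀ s t : ℝ, 0 < s → s ≤ t → ω t / t ≤ ω s / s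

/-- The `BMO_p` norm of `f` on the unit disk (valued in `ℝ≥0∞` so that membership in
`BMO_p` is finiteness): the supremum over all disks `D(z,r) ⊆ 𝔻` with `r ∈ (0, 1-|z|]`
of `{(1/(πr²)) ∫_{D(z,r)} |f(ζ) - (1/(πr²)) ∫_{D(z,r)} f dA|^p dA(ζ)}^{1/p}`. -/
noncomputable def bmoNorm (f : ℂ → ℂ) (p : ℝ) : ℝ≥0∞ :=
  ⨆ (z : ℂ) (_ : ‖z‖ < 1) (r : ℝ) (_ : 0 < r) (_ : r ≤ 1 - ‖z‖),
    ENNReal.ofReal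
      (((π * r ^ 2)⁻¹ *
          ∫ ζ in ball z r,
            ‖f ζ - (π * r ^ 2)⁻¹ • ∫ ξ in ball z r, f ξ‖ ^ p) ^ (1 / p))

/-- The Bloch (Lipschitz) number `β_f = sup_{z ∈ 𝔻} (1-|z|²) Λ_f(z)`,
valued in `ℝ≥0∞`. -/
noncomputable def blochNorm (f : ℂ → ℂ) : ℝ≥0∞ :=
  ⨆ (z : ℂ) (_ : ‖z‖ < 1), ENNReal.ofReal ((1 - ‖z‖ ^ 2) * Lam f z)


lemma aux_expint (k : ℤ) : ∫ θ in (-π)..π, Complex.exp (k * θ * Complex.I) =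
    if k = 0 then ((2 * π : ℝ) : ℂ) else 0 := by
  split_ifs with h
  · subst h; simp; ring
  · have hc : (k : ℂ) * Complex.I ≠ 0 := by simp [h]
    have := integral_exp_mul_complex (a := -π) (b := π) hc
    have e : ∀ θ : ℝ, (k : ℂ) * θ * Complex.I = k * Complex.I * θ := fun θ => by ring
    simp_rw [e]
    rw [this]
    have : Complex.exp (k * Complex.I * (π : ℝ)) = Complex.exp (k * Complex.I * ((-π : ℝ) : ℂ)) := by
      rw [Complex.exp_eq_exp_iff_exists_int]
      refine ⟨k, ?_⟩
      push_cast; ring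
    rw [this]; simp

lemma aux_norm_exp (k : ℤ) (θ : ℝ) : ‖Complex.exp (k * θ * Complex.I)‖ = 1 := by
  have := Complex.norm_exp_ofReal_mul_I (k * θ)
  simpa using this

lemma aux_hasSum_int {ι : Type*} [Countable ι] (e : ι → ℤ) (c : ι → ℂ) (hc : Summable fun i => ‖c i‖)
    (φ ψ : ℝ → ℂ) (hφ : ∀ θ : ℝ, HasSum (fun i => c i * Complex.exp (e i * θ * Complex.I)) (φ θ))
    (hψ : Continuous ψ) (K : ℝ) (hK : ∀ θ, ‖ψ θ‖ ≤ K) :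
    HasSum (fun i => c i * ∫ θ in (-π)..π, ψ θ * Complex.exp (e i * θ * Complex.I))
      (∫ θ in (-π)..π, ψ θ * φ θ) := by
  have := intervalIntegral.hasSum_integral_of_dominated_convergence (μ := volume) (a := -π) (b := π)
    (F := fun i θ => c i * (ψ θ * Complex.exp (e i * θ * Complex.I)))
    (f := fun θ => ψ θ * φ θ) (fun i _ => ‖c i‖ * K) ?_ ?_ ?_ ?_ ?_
  · simpa [intervalIntegral.integral_const_mul] using this
  · intro n
    apply Continuous.aestronglyMeasurable
    fun_prop
  · intro n
    refine Filter.Eventually.of_forall fun θ _ => ?_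
    rw [norm_mul, norm_mul, aux_norm_exp, mul_one]
    gcongr
    exact hK θ
  · refine Filter.Eventually.of_forall fun θ _ => hc.mul_right K
  · simp
  · refine Filter.Eventually.of_forall fun θ _ => ?_
    have := (hφ θ).mul_left (ψ θ)
    have h2 : (fun i => c i * (ψ θ * Complex.exp (e i * θ * Complex.I))) =
        fun i => ψ θ * (c i * Complex.exp (e i * θ * Complex.I)) := by
      funext i; ring
    simpa only [h2] using this

lemma aux_cont {ι : Type*} (e : ι → ℤ) (c : ι → ℂ) (hc : Summable fun i => ‖c i‖)
    (φ : ℝ → ℂ) (hφ : ∀ θ : ℝ, HasSum (fun i => c i * Complex.exp (e i * θ * Complex.I)) (φ θ)) :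
    Continuous φ := by
  have : φ = fun θ : ℝ => ∑' i, c i * Complex.exp (e i * θ * Complex.I) :=
    funext fun θ => (hφ θ).tsum_eq.symm
  rw [this]
  refine continuous_tsum (u := fun i => ‖c i‖) (fun i => by fun_prop) hc fun i θ => ?_
  rw [norm_mul, aux_norm_exp, mul_one]

lemma aux_parseval {ι : Type*} [Countable ι] (e : ι → ℤ) (he : Function.Injective e)
    (c : ι → ℂ) (hc : Summable fun i => ‖c i‖)
    (φ : ℝ → ℂ) (hφ : ∀ θ : ℝ, HasSum (fun i => c i * Complex.exp (e i * θ * Complex.I)) (φ θ)) :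
    HasSum (fun i => 2 * π * ‖c i‖ ^ 2) (∫ θ in (-π)..π, ‖φ θ‖ ^ 2) := by
  classical
  have hcont := aux_cont e c hc φ hφ
  have hb : ∀ θ, ‖φ θ‖ ≤ ∑' i, ‖c i‖ := by
    intro θ
    rw [← (hφ θ).tsum_eq]
    have : ∀ i, ‖c i * Complex.exp (e i * θ * Complex.I)‖ = ‖c i‖ := fun i => by
      rw [norm_mul, aux_norm_exp, mul_one]
    refine (norm_tsum_le_tsum_norm ?_).trans ?_
    · simpa only [this] using hc
    · simp only [this, le_refl]
  -- coefficients
  have h1 : ∀ j, ∫ θ in (-π)..π, Complex.exp ((-e j : ℤ) * θ * Complex.I) * φ θ = 2 * π * c j := by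
    intro j
    have := aux_hasSum_int e c hc φ (fun θ => Complex.exp ((-e j : ℤ) * θ * Complex.I)) hφ
      (by fun_prop) 1 (fun θ => (aux_norm_exp _ _).le)
    refine this.unique ?_
    have h2 : ∀ i, c i * ∫ θ in (-π)..π, Complex.exp ((-e j : ℤ) * θ * Complex.I) *
        Complex.exp (e i * θ * Complex.I) = if i = j then 2 * π * c j else 0 := by
      intro i
      have h3 : ∀ θ : ℝ, Complex.exp ((-e j : ℤ) * θ * Complex.I) *
        Complex.exp (e i * θ * Complex.I) = Complex.exp ((e i - e j : ℤ) * θ * Complex.I) := by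
        intro θ
        rw [← Complex.exp_add]; congr 1; push_cast; ring
      simp_rw [h3]
      rw [aux_expint]
      by_cases hij : i = j
      · subst hij; simp; ring
      · have : e i - e j ≠ 0 := fun h => hij (he (by linarith))
        simp [hij, this]
    simp_rw [h2]
    exact hasSum_ite_eq j _
  have h4 := aux_hasSum_int e c hc φ (fun θ => (starRingEnd ℂ) (φ θ)) hφ
      (by fun_prop) _ (fun θ => by simpa using hb θ)
  have h5 : ∀ i, c i * ∫ θ in (-π)..π, (starRingEnd ℂ) (φ θ) * Complex.exp (e i * θ * Complex.I)
      = ((2 * π * ‖c i‖ ^ 2 : ℝ) : ℂ) := by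
    intro i
    have h6 : ∀ θ : ℝ, (starRingEnd ℂ) (φ θ) * Complex.exp (e i * θ * Complex.I) =
        (starRingEnd ℂ) (Complex.exp ((-e i : ℤ) * θ * Complex.I) * φ θ) := by
      intro θ
      rw [map_mul, ← Complex.exp_conj, mul_comm]
      simp
    simp_rw [h6]
    rw [intervalIntegral.intervalIntegral_eq_integral_uIoc, integral_conj]
    have h7 := h1 i
    rw [intervalIntegral.intervalIntegral_eq_integral_uIoc] at h7
    have hpi : -π ≤ π := by linarith [pi_pos]
    rw [if_pos hpi, one_smul] at h7 ⊢
    rw [h7]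
    simp only [map_mul, Complex.conj_ofReal]
    have := Complex.mul_conj (c i)
    rw [Complex.normSq_eq_norm_sq] at this
    push_cast at this ⊢
    rw [← this]
    rw [show (starRingEnd ℂ) (2 : ℂ) = 2 from Complex.conj_ofNat 2]; ring
  simp_rw [h5] at h4
  have h8 : ∫ θ in (-π)..π, (starRingEnd ℂ) (φ θ) * φ θ =
      ((∫ θ in (-π)..π, ‖φ θ‖ ^ 2 : ℝ) : ℂ) := by
    rw [← intervalIntegral.integral_ofReal]
    congr 1
    ext θ
    rw [mul_comm, Complex.mul_conj, Complex.normSq_eq_norm_sq]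
  rw [h8] at h4
  exact_mod_cast h4

lemma aux_parseval_enn {ι : Type*} [Countable ι] (e : ι → ℤ) (he : Function.Injective e)
    (c : ι → ℂ) (hc : Summable fun i => ‖c i‖)
    (φ : ℝ → ℂ) (hφ : ∀ θ : ℝ, HasSum (fun i => c i * Complex.exp (e i * θ * Complex.I)) (φ θ)) :
    ∫⁻ θ in Ioo (-π) π, ENNReal.ofReal (‖φ θ‖ ^ 2) =
      ENNReal.ofReal (2 * π) * ∑' i, ENNReal.ofReal (‖c i‖ ^ 2) := by
  have h := aux_parseval e he c hc φ hφ
  have hcont := aux_cont e c hc φ hφ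
  have hpi : -π ≤ π := by linarith [pi_pos]
  rw [← ofReal_integral_eq_lintegral_ofReal, ← ENNReal.tsum_mul_left]
  · rw [intervalIntegral.integral_of_le hpi, integral_Ioc_eq_integral_Ioo] at h
    rw [← h.tsum_eq, ENNReal.ofReal_tsum_of_nonneg _ h.summable]
    · congr 1; ext i
      rw [ENNReal.ofReal_mul (by positivity)]
    · intro i; positivity
  · refine Integrable.mono_measure (ν := volume.restrict (Icc (-π) π)) ?_
      (Measure.restrict_mono Ioo_subset_Icc_self le_rfl)
    exact (Continuous.continuousOn (by fun_prop)).integrableOn_compact isCompact_Icc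
  · exact Filter.Eventually.of_forall fun θ => by positivity

lemma aux_mono (u v u' v' : ℝ → ℝ) (hu : ∀ t ∈ Ico (0:ℝ) 1, HasDerivAt u (u' t) t)
    (hv : ∀ t ∈ Ico (0:ℝ) 1, HasDerivAt v (v' t) t) (h0 : u 0 = v 0)
    (h : ∀ t ∈ Ico (0:ℝ) 1, u' t ≤ v' t) : ∀ t ∈ Ico (0:ℝ) 1, u t ≤ v t := by
  have hm : MonotoneOn (fun t => v t - u t) (Ico 0 1) := by
    refine monotoneOn_of_deriv_nonneg (convex_Ico 0 1) ?_ ?_ ?_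
    · intro t ht
      exact ((hv t ht).sub (hu t ht)).continuousAt.continuousWithinAt
    · intro t ht
      have ht := interior_subset ht
      exact ((hv t ht).sub (hu t ht)).differentiableAt.differentiableWithinAt
    · intro t ht
      have ht := interior_subset ht
      have := ((hv t ht).sub (hu t ht)).deriv
      have h2 := h t ht
      change 0 ≤ deriv (v - u) t
      rw [this]; linarith
  intro t ht
  have := hm ⟨le_rfl, one_pos⟩ ht ht.1
  simp only [h0] at this
  linarith

lemma aux_real (c : ℕ → ℝ) (B : ℝ) (hB : 0 ≤ B) (N : ℕ)
    (h : ∀ t ∈ Ico (0:ℝ) 1, ∑ n ∈ Finset.range N, ((n:ℝ) + 1) ^ 2 * c n * t ^ n ≤ B / (1 - t) ^ 2) :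
    ∑ n ∈ Finset.range N, c n / (n + 2) ≤ B := by
  have hd : ∀ (k : ℕ → ℝ) (m : ℕ → ℕ) (t : ℝ), HasDerivAt
      (fun t => ∑ n ∈ Finset.range N, k n * t ^ (m n + 1))
      (∑ n ∈ Finset.range N, k n * ((m n + 1) * t ^ (m n))) t := by
    intro k m t
    refine HasDerivAt.fun_sum fun n _ => ?_
    have := (hasDerivAt_pow (m n + 1) t).const_mul (k n)
    simpa using this
  have d1 : ∀ t ∈ Ico (0:ℝ) 1, HasDerivAt (fun t : ℝ => B * ((1 - t)⁻¹ - 1)) (B / (1 - t) ^ 2) t := by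
    intro t ht
    have h1 : 1 - t ≠ 0 := by linarith [ht.2]
    have := ((((hasDerivAt_id t).const_sub 1).fun_inv h1).sub_const 1).const_mul B
    exact this.congr_deriv (by simp only [id_eq]; ring)
  have d2 : ∀ t ∈ Ico (0:ℝ) 1, HasDerivAt (fun t : ℝ => B * (- Real.log (1 - t))) (B / (1 - t)) t := by
    intro t ht
    have h1 : 1 - t ≠ 0 := by linarith [ht.2]
    have := ((((hasDerivAt_id t).const_sub 1).log h1).neg).const_mul B
    exact this.congr_deriv (by simp only [id_eq]; ring)
  have d3 : ∀ t ∈ Ico (0:ℝ) 1, HasDerivAt (fun t : ℝ => B * ((1 - t) * Real.log (1 - t) + t))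
      (B * (- Real.log (1 - t))) t := by
    intro t ht
    have h1 : 1 - t ≠ 0 := by linarith [ht.2]
    have h2 := (hasDerivAt_id t).const_sub 1
    have := ((h2.mul (h2.log h1)).add (hasDerivAt_id t)).const_mul B
    exact this.congr_deriv (by simp only [id_eq]; field_simp; ring)
  have s1 := aux_mono _ _ _ _ (fun t _ => hd (fun n => ((n:ℝ) + 1) * c n) (fun n => n) t) d1
    (by simp) (by
      intro t ht
      refine le_trans (le_of_eq ?_) (h t ht)
      refine Finset.sum_congr rfl fun n _ => ?_
      ring)
  have s2 := aux_mono _ _ _ _ (fun t _ => hd (fun n => c n) (fun n => n) t) d2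
    (by simp) (by
      intro t ht
      rcases eq_or_lt_of_le ht.1 with h0 | h0
      · subst h0
        have := h 0 ⟨le_rfl, one_pos⟩
        refine le_trans (le_of_eq ?_) (this.trans (by simp))
        refine Finset.sum_congr rfl fun n _ => ?_
        rcases n with _ | n <;> simp
      · have h3 := s1 t ht
        have h1 : 0 < 1 - t := by linarith [ht.2]
        have h4 : B * ((1 - t)⁻¹ - 1) = t * (B / (1 - t)) := by field_simp; ring
        rw [h4] at h3
        refine le_of_mul_le_mul_left (le_trans (le_of_eq ?_) h3) h0
        rw [Finset.mul_sum]
        refine Finset.sum_congr rfl fun n _ => ?_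
        ring)
  have s3 := aux_mono _ _ _ _ (fun t _ => hd (fun n => c n / (n + 2)) (fun n => n + 1) t) d3
    (by simp) (by
      intro t ht
      refine le_trans (le_of_eq ?_) (s2 t ht)
      refine Finset.sum_congr rfl fun n _ => ?_
      push_cast
      field_simp
      ring)
  have s4 : ∀ t ∈ Ico (0:ℝ) 1, ∑ n ∈ Finset.range N, c n / (n + 2) * t ^ (n + 1 + 1) ≤ B := by
    intro t ht
    refine (s3 t ht).trans ?_
    have h1 : 0 < 1 - t := by linarith [ht.2]
    have h2 : Real.log (1 - t) ≤ 0 := Real.log_nonpos h1.le (by linarith [ht.1])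
    have h3 := mul_nonpos_of_nonneg_of_nonpos h1.le h2
    nlinarith [ht.2]
  have hc : Filter.Tendsto (fun t : ℝ => ∑ n ∈ Finset.range N, c n / (n + 2) * t ^ (n + 1 + 1))
      (nhdsWithin 1 (Iio 1)) (nhds (∑ n ∈ Finset.range N, c n / (n + 2) * 1 ^ (n + 1 + 1))) :=
    (Continuous.tendsto (by fun_prop) 1).mono_left nhdsWithin_le_nhds
  simp only [one_pow, mul_one] at hc
  refine le_of_tendsto hc ?_
  filter_upwards [Ico_mem_nhdsLT (zero_lt_one (α := ℝ))] with t ht using s4 t ht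

lemma aux_hs {E : Type*} [AddCommMonoid E] [TopologicalSpace E] {f g : ℕ → E} {x : E}
    (h : ∀ n, f n = g n) (hg : HasSum g x) : HasSum f x := by
  rw [funext h]; exact hg

lemma aux_taylor (H : ℂ → ℂ) (hH : DifferentiableOn ℂ H (ball 0 1)) :
    ∃ a : ℕ → ℂ, a 0 = H 0 ∧ (∀ z ∈ ball (0:ℂ) 1, HasSum (fun n => a n * z ^ n) (H z)) ∧
      ∀ z ∈ ball (0:ℂ) 1, HasSum (fun n : ℕ => ((n:ℂ) + 1) * a (n + 1) * z ^ n) (deriv H z) := by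
  refine ⟨fun n => (n.factorial : ℂ)⁻¹ * iteratedDeriv n H 0, by simp, fun z hz => ?_, fun z hz => ?_⟩
  · have := Complex.hasSum_taylorSeries_on_ball hH hz
    have e : (fun n : ℕ => (n.factorial : ℂ)⁻¹ • (z - 0) ^ n • iteratedDeriv n H 0) =
      fun n : ℕ => (n.factorial : ℂ)⁻¹ * iteratedDeriv n H 0 * z ^ n := by
      funext n; simp only [smul_eq_mul, sub_zero]; ring
    rwa [e] at this
  · have := Complex.hasSum_taylorSeries_on_ball (hH.deriv isOpen_ball) hz
    have e : (fun n : ℕ => (n.factorial : ℂ)⁻¹ • (z - 0) ^ n • iteratedDeriv n (deriv H) 0) =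
      fun n : ℕ => ((n : ℂ) + 1) * (((n + 1).factorial : ℂ)⁻¹ * iteratedDeriv (n + 1) H 0) * z ^ n := by
      funext n
      rw [iteratedDeriv_succ', Nat.factorial_succ]
      have h1 : (n.factorial : ℂ) ≠ 0 := by exact_mod_cast n.factorial_ne_zero
      have h2 : (n : ℂ) + 1 ≠ 0 := by exact_mod_cast n.succ_ne_zero
      simp only [smul_eq_mul, sub_zero]
      push_cast
      field_simp
    rwa [e] at this

lemma aux_circ_mem (ρ : ℝ) (h0 : 0 ≤ ρ) (h1 : ρ < 1) (θ : ℝ) :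
    (ρ : ℂ) * Complex.exp (θ * Complex.I) ∈ ball (0:ℂ) 1 := by
  simp [Complex.norm_exp_ofReal_mul_I, abs_of_nonneg h0, h1]

lemma aux_circ_norm (ρ : ℝ) (h0 : 0 ≤ ρ) (θ : ℝ) :
    ‖(ρ : ℂ) * Complex.exp (θ * Complex.I)‖ = ρ := by
  simp [Complex.norm_exp_ofReal_mul_I, abs_of_nonneg h0]

lemma aux_circ_pow (ρ : ℝ) (θ : ℝ) (n : ℕ) :
    ((ρ : ℂ) * Complex.exp (θ * Complex.I)) ^ n =
      (ρ : ℂ) ^ n * Complex.exp ((n : ℤ) * θ * Complex.I) := by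
  rw [mul_pow, ← Complex.exp_nat_mul]; congr 2; push_cast; ring

lemma aux_summ (a : ℕ → ℂ) (φ : ℂ → ℂ) (h : ∀ z ∈ ball (0:ℂ) 1, HasSum (fun n => a n * z ^ n) (φ z))
    (ρ : ℝ) (h0 : 0 ≤ ρ) (h1 : ρ < 1) : Summable fun n => ‖a n * (ρ:ℂ) ^ n‖ := by
  have := (h (ρ : ℂ) (by simp [abs_of_nonneg h0, h1])).summable
  exact summable_norm_iff.2 this

lemma aux_parseval_pow (a : ℕ → ℂ) (φ : ℂ → ℂ)
    (h : ∀ z ∈ ball (0:ℂ) 1, HasSum (fun n => a n * z ^ n) (φ z))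
    (ρ : ℝ) (h0 : 0 ≤ ρ) (h1 : ρ < 1) :
    HasSum (fun n => 2 * π * ‖a n * (ρ : ℂ) ^ n‖ ^ 2)
      (∫ θ in (-π)..π, ‖φ (ρ * Complex.exp (θ * Complex.I))‖ ^ 2) := by
  refine aux_parseval (fun n : ℕ => (n : ℤ)) Nat.cast_injective _ (aux_summ a φ h ρ h0 h1)
    (fun θ => φ (ρ * Complex.exp (θ * Complex.I))) fun θ => ?_
  have := h _ (aux_circ_mem ρ h0 h1 θ)
  simp_rw [aux_circ_pow, ← mul_assoc] at this
  exact this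

lemma aux_parseval_mix (a b : ℕ → ℂ) (H G : ℂ → ℂ) (ha : a 0 = 0) (hb : b 0 = 0)
    (hH : ∀ z ∈ ball (0:ℂ) 1, HasSum (fun n => a n * z ^ n) (H z))
    (hG : ∀ z ∈ ball (0:ℂ) 1, HasSum (fun n => b n * z ^ n) (G z))
    (ρ : ℝ) (h0 : 0 ≤ ρ) (h1 : ρ < 1) :
    ∫⁻ θ in Ioo (-π) π, ENNReal.ofReal (‖H (ρ * Complex.exp (θ * Complex.I)) +
        (starRingEnd ℂ) (G (ρ * Complex.exp (θ * Complex.I)))‖ ^ 2) =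
      ENNReal.ofReal (2 * π) * ∑' n : ℕ, ENNReal.ofReal
        ((‖a (n + 1)‖ ^ 2 + ‖b (n + 1)‖ ^ 2) * ρ ^ (2 * n + 2)) := by
  let e : ℕ ⊕ ℕ → ℤ := Sum.elim (fun n => (n : ℤ) + 1) (fun n => -((n : ℤ) + 1))
  let c : ℕ ⊕ ℕ → ℂ := Sum.elim (fun n => a (n + 1) * (ρ:ℂ) ^ (n + 1))
    (fun n => (starRingEnd ℂ) (b (n + 1) * (ρ:ℂ) ^ (n + 1)))
  have he : Function.Injective e := by
    rintro (n | n) (m | m) hnm <;> simp only [e, Sum.elim_inl, Sum.elim_inr] at hnm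
    · congr 1; omega
    · omega
    · omega
    · congr 1; omega
  have hc : Summable fun i => ‖c i‖ := by
    have sa := (summable_nat_add_iff 1).2 (aux_summ a H hH ρ h0 h1)
    have sb := (summable_nat_add_iff 1).2 (aux_summ b G hG ρ h0 h1)
    refine (HasSum.sum (f := fun i => ‖c i‖) (a := _)
      (b := ∑' n, ‖b (n + 1) * (ρ:ℂ) ^ (n + 1)‖) sa.hasSum ?_).summable
    · refine aux_hs (fun n => ?_) sb.hasSum
      simp only [Function.comp, c, Sum.elim_inr, RCLike.norm_conj]
  rw [aux_parseval_enn e he c hc (fun θ => H (ρ * Complex.exp (θ * Complex.I)) +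
        (starRingEnd ℂ) (G (ρ * Complex.exp (θ * Complex.I))))]
  · congr 1
    rw [Summable.tsum_sum ENNReal.summable ENNReal.summable, ← ENNReal.tsum_add]
    refine tsum_congr fun n => ?_
    simp only [c, Sum.elim_inl, Sum.elim_inr, RCLike.norm_conj]
    rw [← ENNReal.ofReal_add (by positivity) (by positivity)]
    congr 1
    simp only [norm_mul, norm_pow, Complex.norm_real, Real.norm_eq_abs, abs_of_nonneg h0]
    ring
  · intro θ
    refine HasSum.sum ?_ ?_
    · have := (hasSum_nat_add_iff' 1).2 (hH _ (aux_circ_mem ρ h0 h1 θ))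
      simp only [Finset.range_one, Finset.sum_singleton, ha, zero_mul, sub_zero] at this
      refine aux_hs (fun n => ?_) this
      simp only [Function.comp, c, e, Sum.elim_inl]
      rw [aux_circ_pow]; push_cast; ring
    · have := (hasSum_nat_add_iff' 1).2 (hG _ (aux_circ_mem ρ h0 h1 θ))
      simp only [Finset.range_one, Finset.sum_singleton, hb, zero_mul, sub_zero] at this
      have := (Complex.hasSum_conj'.2 this)
      refine aux_hs (fun n => ?_) this
      simp only [Function.comp, c, e, Sum.elim_inr]
      rw [aux_circ_pow, map_mul, map_mul, map_mul, ← Complex.exp_conj, mul_assoc]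
      congr 3
      simp
      ring

lemma aux_coef (a b : ℕ → ℂ) (H G : ℂ → ℂ)
    (hH : ∀ z ∈ ball (0:ℂ) 1, HasSum (fun n => a n * z ^ n) (H z))
    (hG : ∀ z ∈ ball (0:ℂ) 1, HasSum (fun n => b n * z ^ n) (G z))
    (hHc : ContinuousOn H (ball 0 1)) (hGc : ContinuousOn G (ball 0 1))
    (B : ℝ) (hb : ∀ ζ ∈ ball (0:ℂ) 1, (1 - ‖ζ‖ ^ 2) ^ 2 * (‖H ζ‖ ^ 2 + ‖G ζ‖ ^ 2) ≤ B)
    (N : ℕ) (t : ℝ) (ht : t ∈ Ico (0:ℝ) 1) :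
    ∑ n ∈ Finset.range N, (‖a n‖ ^ 2 + ‖b n‖ ^ 2) * t ^ n ≤ B / (1 - t) ^ 2 := by
  have h0 : 0 ≤ √t := Real.sqrt_nonneg t
  have h1 : √t < 1 := by rw [Real.sqrt_lt' one_pos]; simpa using ht.2
  have hs : √t ^ 2 = t := Real.sq_sqrt ht.1
  have hpi : -π ≤ π := by linarith [pi_pos]
  have pH := aux_parseval_pow a H hH _ h0 h1
  have pG := aux_parseval_pow b G hG _ h0 h1
  have cH : ∀ φ : ℂ → ℂ, ContinuousOn φ (ball 0 1) →
      Continuous fun θ : ℝ => ‖φ ((√t : ℝ) * Complex.exp (θ * Complex.I))‖ ^ 2 := by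
    intro φ hφ
    refine Continuous.pow (Continuous.norm ?_) 2
    exact hφ.comp_continuous (by fun_prop) fun θ => aux_circ_mem _ h0 h1 θ
  have p := pH.add pG
  rw [← intervalIntegral.integral_add ((cH H hHc).intervalIntegrable _ _)
    ((cH G hGc).intervalIntegrable _ _)] at p
  have ub : ∫ θ in (-π)..π, (‖H ((√t : ℝ) * Complex.exp (θ * Complex.I))‖ ^ 2 +
      ‖G ((√t : ℝ) * Complex.exp (θ * Complex.I))‖ ^ 2) ≤ ∫ θ in (-π)..π, B / (1 - t) ^ 2 := by
    refine intervalIntegral.integral_mono hpi (((cH H hHc).add (cH G hGc)).intervalIntegrable _ _)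
      (by simp) fun θ => ?_
    have := hb _ (aux_circ_mem _ h0 h1 θ)
    rw [aux_circ_norm _ h0, hs] at this
    have h2 : 0 < 1 - t := by linarith [ht.2]
    rw [le_div_iff₀ (by positivity)]
    linarith
  rw [intervalIntegral.integral_const, smul_eq_mul] at ub
  have := (sum_le_hasSum (Finset.range N) (fun n _ => by positivity) p).trans ub
  have e : ∑ n ∈ Finset.range N, (2 * π * ‖a n * ((√t : ℝ) : ℂ) ^ n‖ ^ 2 +
      2 * π * ‖b n * ((√t : ℝ) : ℂ) ^ n‖ ^ 2) =
      2 * π * ∑ n ∈ Finset.range N, (‖a n‖ ^ 2 + ‖b n‖ ^ 2) * t ^ n := by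
    rw [Finset.mul_sum]
    refine Finset.sum_congr rfl fun n _ => ?_
    simp only [norm_mul, norm_pow, Complex.norm_real, Real.norm_eq_abs, abs_of_nonneg h0]
    rw [mul_pow, mul_pow, ← pow_mul, mul_comm n 2, pow_mul, hs]; ring
  rw [e] at this
  have e2 : π - -π = 2 * π := by ring
  rw [e2] at this
  exact le_of_mul_le_mul_left this (by positivity)

lemma aux_core (H G : ℂ → ℂ) (hH : DifferentiableOn ℂ H (ball 0 1))
    (hG : DifferentiableOn ℂ G (ball 0 1)) (H0 : H 0 = 0) (G0 : G 0 = 0) (B : ℝ) (hB : 0 ≤ B)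
    (hb : ∀ ζ ∈ ball (0:ℂ) 1, (1 - ‖ζ‖ ^ 2) ^ 2 * (‖deriv H ζ‖ ^ 2 + ‖deriv G ζ‖ ^ 2) ≤ B) :
    ∫⁻ ζ in ball (0:ℂ) 1, ENNReal.ofReal (‖H ζ + (starRingEnd ℂ) (G ζ)‖ ^ 2) ≤
      ENNReal.ofReal (π * B) := by
  obtain ⟨a, a0, ha, ha'⟩ := aux_taylor H hH
  obtain ⟨b, b0, hb1, hb'⟩ := aux_taylor G hG
  rw [H0] at a0
  rw [G0] at b0
  set c : ℕ → ℝ := fun n => ‖a (n + 1)‖ ^ 2 + ‖b (n + 1)‖ ^ 2 with hc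
  have c0 : ∀ n, 0 ≤ c n := fun n => by positivity
  have key : ∀ N, ∑ n ∈ Finset.range N, c n / (n + 2) ≤ B := by
    intro N
    refine aux_real c B hB N fun t ht => ?_
    have := aux_coef _ _ _ _ ha' hb' (hH.deriv isOpen_ball).continuousOn
      (hG.deriv isOpen_ball).continuousOn B hb N t ht
    refine le_trans (le_of_eq ?_) this
    refine Finset.sum_congr rfl fun n _ => ?_
    have : ‖(n : ℂ) + 1‖ = (n : ℝ) + 1 := by
      have := Complex.norm_natCast (n + 1)
      push_cast at this; exact this
    rw [norm_mul, norm_mul, this]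
    simp only [hc]; ring
  have key2 : ∑' n, ENNReal.ofReal (c n / (n + 2)) ≤ ENNReal.ofReal B := by
    refine ENNReal.tsum_le_of_sum_range_le fun N => ?_
    rw [← ENNReal.ofReal_sum_of_nonneg fun n _ => by have := c0 n; positivity]
    exact ENNReal.ofReal_le_ofReal (key N)
  rw [← lintegral_indicator measurableSet_ball, ← Complex.lintegral_comp_polarCoord_symm,
    polarCoord_target, Measure.volume_eq_prod, ← Measure.prod_restrict]
  refine (lintegral_prod_le _).trans ?_
  calc _ ≤ ∫⁻ ρ in Ioi (0:ℝ), ∑' n : ℕ, (Ioo (0:ℝ) 1).indicator (fun ρ => ENNReal.ofReal (2 * π * c n) *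
        ENNReal.ofReal (ρ ^ (2 * n + 3))) ρ := by
        refine setLIntegral_mono' measurableSet_Ioi fun ρ hρ => ?_
        have h0 : 0 < ρ := hρ
        by_cases h1 : ρ < 1
        · have hm : ρ ∈ Ioo (0:ℝ) 1 := ⟨h0, h1⟩
          have e : ∀ θ : ℝ, ENNReal.ofReal ρ • (ball (0:ℂ) 1).indicator
              (fun ζ => ENNReal.ofReal (‖H ζ + (starRingEnd ℂ) (G ζ)‖ ^ 2))
              (Complex.polarCoord.symm (ρ, θ)) = ENNReal.ofReal ρ *
              ENNReal.ofReal (‖H (ρ * Complex.exp (θ * Complex.I)) +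
        (starRingEnd ℂ) (G (ρ * Complex.exp (θ * Complex.I)))‖ ^ 2) := by
            intro θ
            have e1 : Complex.polarCoord.symm (ρ, θ) = ρ * Complex.exp (θ * Complex.I) := by
              rw [Complex.polarCoord_symm_apply, Complex.exp_mul_I]
              push_cast; rfl
            rw [e1, indicator_of_mem (aux_circ_mem ρ h0.le h1 θ), smul_eq_mul]
          simp only [e]
          rw [lintegral_const_mul' _ _ ENNReal.ofReal_ne_top,
            aux_parseval_mix a b H G a0 b0 ha hb1 ρ h0.le h1, ← ENNReal.tsum_mul_left,
            ← ENNReal.tsum_mul_left]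
          refine ENNReal.tsum_le_tsum fun n => le_of_eq ?_
          rw [indicator_of_mem hm, ← ENNReal.ofReal_mul (by positivity),
            ← ENNReal.ofReal_mul (by positivity), ← ENNReal.ofReal_mul (by have := c0 n; positivity)]
          congr 1
          simp only [hc]; ring
        · have e : ∀ θ : ℝ, ENNReal.ofReal ρ • (ball (0:ℂ) 1).indicator
              (fun ζ => ENNReal.ofReal (‖H ζ + (starRingEnd ℂ) (G ζ)‖ ^ 2))
              (Complex.polarCoord.symm (ρ, θ)) = 0 := by
            intro θ
            have e1 : Complex.polarCoord.symm (ρ, θ) = ρ * Complex.exp (θ * Complex.I) := by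
              rw [Complex.polarCoord_symm_apply, Complex.exp_mul_I]
              push_cast; rfl
            rw [e1, indicator_of_notMem, smul_zero]
            rw [mem_ball_zero_iff, aux_circ_norm ρ h0.le]; exact h1
          simp only [e, lintegral_zero, zero_le]
    _ = ∑' n : ℕ, ∫⁻ ρ in Ioo (0:ℝ) 1, ENNReal.ofReal (2 * π * c n) *
        ENNReal.ofReal (ρ ^ (2 * n + 3)) := by
        rw [lintegral_tsum]
        · refine tsum_congr fun n => ?_
          rw [lintegral_indicator measurableSet_Ioo, Measure.restrict_restrict measurableSet_Ioo,
            inter_eq_left.2 Ioo_subset_Ioi_self]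
        · intro n
          refine (Measurable.indicator ?_ measurableSet_Ioo).aemeasurable
          fun_prop
    _ = ∑' n : ℕ, ENNReal.ofReal π * ENNReal.ofReal (c n / (n + 2)) := by
        refine tsum_congr fun n => ?_
        rw [lintegral_const_mul' _ _ ENNReal.ofReal_ne_top, ← ofReal_integral_eq_lintegral_ofReal]
        · rw [← integral_Ioc_eq_integral_Ioo, ← intervalIntegral.integral_of_le zero_le_one,
            integral_pow, ← ENNReal.ofReal_mul (by have := c0 n; positivity),
            ← ENNReal.ofReal_mul (by positivity)]
          congr 1
          push_cast
          simp
          field_simp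
          ring
        · refine Integrable.mono_measure (ν := volume.restrict (Icc (0:ℝ) 1)) ?_
            (Measure.restrict_mono Ioo_subset_Icc_self le_rfl)
          exact (Continuous.continuousOn (by fun_prop)).integrableOn_compact isCompact_Icc
        · filter_upwards [self_mem_ae_restrict measurableSet_Ioo] with ρ hρ
          exact pow_nonneg hρ.1.le _
    _ ≤ _ := by
        rw [ENNReal.tsum_mul_left, ENNReal.ofReal_mul pi_pos.le]
        gcongr

lemma aux_decomp (f : ℂ → ℂ) (hf : IsHarmonicOn f (ball (0 : ℂ) 1)) :
    ∃ h g : ℂ → ℂ, DifferentiableOn ℂ h (ball 0 1) ∧ DifferentiableOn ℂ g (ball 0 1) ∧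
      ∀ z ∈ ball (0:ℂ) 1, f z = h z + (starRingEnd ℂ) (g z) := by
  have hh : InnerProductSpace.HarmonicOnNhd f (ball 0 1) := by
    intro x hx
    refine ⟨hf.1.contDiffAt (isOpen_ball.mem_nhds hx), ?_⟩
    filter_upwards [isOpen_ball.mem_nhds hx] with y hy
    have hc : ContDiffAt ℝ 2 f y := hf.1.contDiffAt (isOpen_ball.mem_nhds hy)
    have hd : DifferentiableAt ℝ (fderiv ℝ f) y :=
      (hc.fderiv_right (m := 1) (by norm_num)).differentiableAt (by norm_num)
    have h2 := hf.2 y hy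
    rw [fderiv_clm_apply hd (differentiableAt_const _),
      fderiv_clm_apply hd (differentiableAt_const _)] at h2
    rw [InnerProductSpace.laplacian_eq_iteratedFDeriv_complexPlane]
    simp only [iteratedFDeriv_two_apply]
    simpa using h2
  obtain ⟨P, hP, hP'⟩ := (hh.comp_CLM Complex.reCLM).exists_analyticOnNhd_ball_re_eq
  obtain ⟨Q, hQ, hQ'⟩ := (hh.comp_CLM Complex.imCLM).exists_analyticOnNhd_ball_re_eq
  have dP := hP.differentiableOn
  have dQ := hQ.differentiableOn
  refine ⟨fun z => (P z + Complex.I * Q z) / 2, fun z => (P z - Complex.I * Q z) / 2,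
    (dP.add (dQ.const_mul _)).div_const _, (dP.sub (dQ.const_mul _)).div_const _, fun z hz => ?_⟩
  have h1 : (P z).re = (f z).re := hP' hz
  have h2 : (Q z).re = (f z).im := hQ' hz
  have c2 : (starRingEnd ℂ) (2 : ℂ) = 2 := Complex.conj_ofNat 2
  have e1 : P z + (starRingEnd ℂ) (P z) = 2 * (f z).re := by rw [Complex.add_conj, h1]; push_cast; rfl
  have e2 : Q z + (starRingEnd ℂ) (Q z) = 2 * (f z).im := by rw [Complex.add_conj, h2]; push_cast; rfl
  simp only [map_div₀, map_sub, map_mul, Complex.conj_I, c2]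
  have e3 := Complex.re_add_im (f z)
  linear_combination -e3 - e1 / 2 - Complex.I * e2 / 2

lemma aux_lam (f h g : ℂ → ℂ) (hh : DifferentiableOn ℂ h (ball 0 1))
    (hg : DifferentiableOn ℂ g (ball 0 1))
    (hfe : ∀ z ∈ ball (0:ℂ) 1, f z = h z + (starRingEnd ℂ) (g z)) (z : ℂ) (hz : z ∈ ball (0:ℂ) 1) :
    Lam f z = ‖deriv h z‖ + ‖deriv g z‖ := by
  have hn := isOpen_ball.mem_nhds hz
  have h1 := ((hh.differentiableAt hn).hasDerivAt.hasFDerivAt.restrictScalars ℝ)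
  have h2 := ((hg.differentiableAt hn).hasDerivAt.hasFDerivAt.restrictScalars ℝ)
  have h3 := h1.add ((Complex.conjCLE.toContinuousLinearMap.hasFDerivAt).comp z h2)
  have h4 : HasFDerivAt f _ z := h3.congr_of_eventuallyEq (by
    filter_upwards [hn] with y hy
    rw [hfe y hy]; rfl)
  have w1 : wirtingerZ f z = deriv h z := by
    unfold wirtingerZ
    rw [h4.fderiv]
    simp
    ring_nf
    simp
    try ring
  have w2 : wirtingerZbar f z = (starRingEnd ℂ) (deriv g z) := by
    unfold wirtingerZbar
    rw [h4.fderiv]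
    simp
    ring_nf
    simp
    try ring
  rw [Lam, w1, w2, RCLike.norm_conj]

lemma aux_cov {E : Type*} [NormedAddCommGroup E] [NormedSpace ℝ E] (φ : ℂ → E) (z : ℂ) (r : ℝ)
    (hr : 0 < r) : (π * r ^ 2)⁻¹ • ∫ ζ in ball z r, φ ζ =
      π⁻¹ • ∫ ζ in ball (0:ℂ) 1, φ (z + r • ζ) := by
  have h1 := Measure.setIntegral_comp_smul_of_pos volume (fun x : ℂ => φ (z + x)) (ball 0 1) hr
  rw [h1, smul_unitBall_of_pos hr, Complex.finrank_real_complex]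
  have h2 := (measurePreserving_add_left (volume : Measure ℂ) z).setIntegral_preimage_emb
    (measurableEmbedding_addLeft z) φ (ball z r)
  rw [preimage_add_ball, sub_self] at h2
  rw [h2, smul_smul, mul_inv]

lemma aux_var (F : ℂ → ℂ) (c : ℂ) (B : ℝ) (hB : 0 ≤ B)
    (hF : ContinuousOn F (ball 0 1))
    (h : ∫⁻ ζ in ball (0:ℂ) 1, ENNReal.ofReal (‖F ζ - c‖ ^ 2) ≤ ENNReal.ofReal (π * B)) :
    π⁻¹ * ∫ ζ in ball (0:ℂ) 1, ‖F ζ - π⁻¹ • ∫ ξ in ball (0:ℂ) 1, F ξ‖ ^ 2 ≤ B := by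
  set μ := (volume : Measure ℂ).restrict (ball 0 1) with hμ
  have hfin : IsFiniteMeasure μ := ⟨by simp [hμ]⟩
  have hvol : μ.real univ = π := by
    simp [hμ, Measure.real]
  set X : ℂ → ℂ := fun ζ => F ζ - c with hX
  have hm : AEStronglyMeasurable X μ :=
    (hF.sub continuousOn_const).aestronglyMeasurable measurableSet_ball
  have hi2 : Integrable (fun ζ => ‖X ζ‖ ^ 2) μ := by
    refine ⟨(hm.norm.pow 2), ?_⟩
    rw [hasFiniteIntegral_iff_ofReal (Filter.Eventually.of_forall fun ζ => by positivity)]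
    exact h.trans_lt ENNReal.ofReal_lt_top
  have hi : Integrable X μ := ((memLp_two_iff_integrable_sq_norm hm).2 hi2).integrable (by norm_num)
  have hle : ∫ ζ, ‖X ζ‖ ^ 2 ∂μ ≤ π * B := by
    rw [integral_eq_lintegral_of_nonneg_ae (Filter.Eventually.of_forall fun ζ => by positivity) hi2.1]
    exact ENNReal.toReal_le_of_le_ofReal (by positivity) h
  set m : ℂ := π⁻¹ • ∫ ξ, X ξ ∂μ with hmm
  have e1 : ∀ ζ, F ζ - π⁻¹ • ∫ ξ, F ξ ∂μ = X ζ - m := by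
    intro ζ
    have : ∫ ξ, X ξ ∂μ = (∫ ξ, F ξ ∂μ) - π • c := by
      have hFi : Integrable F μ := by
        have := hi.add (integrable_const c)
        refine this.congr (Filter.Eventually.of_forall fun ζ => ?_)
        simp [hX]
      rw [hX, integral_sub hFi (integrable_const c), integral_const, hvol]
    rw [hmm, this, smul_sub, smul_smul, inv_mul_cancel₀ pi_ne_zero, one_smul]
    simp only [hX]; ring
  simp_rw [e1]
  have e2 : ∀ ζ, ‖X ζ - m‖ ^ 2 = ‖X ζ‖ ^ 2 - 2 * inner ℝ m (X ζ) + ‖m‖ ^ 2 := by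
    intro ζ
    rw [norm_sub_sq_real, real_inner_comm]
  simp_rw [e2]
  have hin : Integrable (fun ζ => inner ℝ m (X ζ)) μ := hi.const_inner m
  have hsub : Integrable (fun ζ => ‖X ζ‖ ^ 2 - 2 * inner ℝ m (X ζ)) μ := hi2.sub (hin.const_mul 2)
  rw [integral_add hsub (integrable_const _),
    integral_sub hi2 (hin.const_mul 2), integral_const_mul, integral_inner hi, integral_const, hvol]
  have e3 : ∫ ξ, X ξ ∂μ = π • m := by
    rw [hmm, smul_smul, mul_inv_cancel₀ pi_ne_zero, one_smul]
  rw [e3, inner_smul_right, real_inner_self_eq_norm_sq, smul_eq_mul]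
  rw [inv_mul_le_iff₀ pi_pos]
  nlinarith [mul_nonneg pi_pos.le (sq_nonneg ‖m‖)]

lemma aux_conv (z ζ : ℂ) (r : ℝ) (hr : 0 < r) (hrz : r ≤ 1 - ‖z‖) (hζ : ‖ζ‖ < 1) :
    r * (1 - ‖ζ‖ ^ 2) ≤ 1 - ‖z + r • ζ‖ ^ 2 := by
  have h1 : ‖z + r • ζ‖ ≤ (1 - r) + r * ‖ζ‖ := by
    refine (norm_add_le _ _).trans ?_
    rw [norm_smul, Real.norm_eq_abs, abs_of_pos hr]; linarith
  have h2 : ‖z + r • ζ‖ ^ 2 ≤ ((1 - r) + r * ‖ζ‖) ^ 2 := by gcongr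
  have h3 : 0 ≤ r * (1 - r) * (1 - ‖ζ‖) ^ 2 := by
    have : 0 ≤ 1 - r := by linarith [norm_nonneg z]
    positivity
  nlinarith

/-- if `f` is harmonic in the unit disk with finite Bloch number
`β_f = sup_{z ∈ 𝔻} (1-|z|²) Λ_f(z)`, then `‖f‖_{BMO₂} ≤ β_f`. -/
theorem stmt10 (f : ℂ → ℂ) (hf : IsHarmonicOn f (ball (0 : ℂ) 1))
    (hβ : blochNorm f ≠ ⊤) :
    bmoNorm f 2 ≤ blochNorm f := by
  obtain ⟨h, g, hh, hg, hfe⟩ := aux_decomp f hf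
  set b := (blochNorm f).toReal with hb
  have b0 : 0 ≤ b := ENNReal.toReal_nonneg
  have hbl : ∀ z : ℂ, ‖z‖ < 1 → (1 - ‖z‖ ^ 2) * Lam f z ≤ b := by
    intro z hz
    have : ENNReal.ofReal ((1 - ‖z‖ ^ 2) * Lam f z) ≤ blochNorm f :=
      le_iSup₂ (f := fun (z : ℂ) (_ : ‖z‖ < 1) => ENNReal.ofReal ((1 - ‖z‖ ^ 2) * Lam f z)) z hz
    rw [hb]
    exact (ENNReal.ofReal_le_iff_le_toReal hβ).1 this
  unfold bmoNorm
  refine iSup_le fun z => iSup_le fun hz => iSup_le fun r => iSup_le fun hr => iSup_le fun hrz => ?_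
  rw [ENNReal.ofReal_le_iff_le_toReal hβ, ← hb, aux_cov f z r hr]
  have e := aux_cov (fun ζ => ‖f ζ - π⁻¹ • ∫ ξ in ball (0:ℂ) 1, f (z + r • ξ)‖ ^ (2:ℝ)) z r hr
  rw [smul_eq_mul, smul_eq_mul] at e
  rw [e]
  simp only [Real.rpow_two]
  rw [← Real.sqrt_eq_rpow, Real.sqrt_le_left b0]
  have hmem : ∀ ζ ∈ ball (0:ℂ) 1, z + r • ζ ∈ ball (0:ℂ) 1 := by
    intro ζ hζ
    rw [mem_ball_zero_iff] at hζ ⊢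
    have h1 := aux_conv z ζ r hr hrz hζ
    have h2 : 0 < r * (1 - ‖ζ‖ ^ 2) := by
      have : ‖ζ‖ ^ 2 < 1 := by nlinarith [norm_nonneg ζ]
      exact mul_pos hr (by linarith)
    nlinarith [norm_nonneg (z + r • ζ)]
  have hz' : z ∈ ball (0:ℂ) 1 := mem_ball_zero_iff.2 hz
  have hder : ∀ ζ : ℂ, HasDerivAt (fun ζ : ℂ => z + r • ζ) (r : ℂ) ζ := by
    intro ζ
    have := ((hasDerivAt_id ζ).const_mul (r : ℂ)).const_add z
    simpa using this
  have hcomp : ∀ φ : ℂ → ℂ, DifferentiableOn ℂ φ (ball 0 1) → ∀ ζ ∈ ball (0:ℂ) 1,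
      HasDerivAt (fun ζ => φ (z + r • ζ) - φ z) (deriv φ (z + r • ζ) * r) ζ := by
    intro φ hφ ζ hζ
    have h1 := (hφ.differentiableAt (isOpen_ball.mem_nhds (hmem ζ hζ))).hasDerivAt
    exact (h1.comp ζ (hder ζ)).sub_const _
  refine aux_var (fun ζ => f (z + r • ζ)) (f z) (b ^ 2) (by positivity) ?_ ?_
  · exact hf.1.continuousOn.comp (by fun_prop) hmem
  · refine le_trans (le_of_eq ?_) (aux_core (fun ζ => h (z + r • ζ) - h z)
      (fun ζ => g (z + r • ζ) - g z)
      (fun ζ hζ => (hcomp h hh ζ hζ).differentiableAt.differentiableWithinAt)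
      (fun ζ hζ => (hcomp g hg ζ hζ).differentiableAt.differentiableWithinAt)
      (by simp) (by simp) (b ^ 2) (by positivity) ?_)
    · refine setLIntegral_congr_fun measurableSet_ball fun ζ hζ => ?_
      simp only [hfe _ (hmem ζ hζ), hfe z hz', map_sub]
      congr 3
      ring
    · intro ζ hζ
      rw [(hcomp h hh ζ hζ).deriv, (hcomp g hg ζ hζ).deriv]
      have h1 := aux_conv z ζ r hr hrz (mem_ball_zero_iff.1 hζ)
      have h2 := hbl _ (mem_ball_zero_iff.1 (hmem ζ hζ))
      rw [aux_lam f h g hh hg hfe _ (hmem ζ hζ)] at h2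
      have h3 : ‖ζ‖ ^ 2 < 1 := by nlinarith [norm_nonneg ζ, mem_ball_zero_iff.1 hζ]
      rw [norm_mul, norm_mul, Complex.norm_real, Real.norm_eq_abs, abs_of_pos hr]
      set x := ‖deriv h (z + r • ζ)‖
      set y := ‖deriv g (z + r • ζ)‖
      have hx : 0 ≤ x := norm_nonneg _
      have hy : 0 ≤ y := norm_nonneg _
      have h4 : r * (1 - ‖ζ‖ ^ 2) * (x + y) ≤ b :=
        (mul_le_mul_of_nonneg_right h1 (by positivity)).trans h2
      have h5 : 0 ≤ r * (1 - ‖ζ‖ ^ 2) := mul_nonneg hr.le (by linarith)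
      calc (1 - ‖ζ‖ ^ 2) ^ 2 * ((x * r) ^ 2 + (y * r) ^ 2)
          = (r * (1 - ‖ζ‖ ^ 2)) ^ 2 * (x ^ 2 + y ^ 2) := by ring
        _ ≤ (r * (1 - ‖ζ‖ ^ 2)) ^ 2 * (x + y) ^ 2 := by
            gcongr
            nlinarith [mul_nonneg hx hy]
        _ = (r * (1 - ‖ζ‖ ^ 2) * (x + y)) ^ 2 := by ring
        _ ≤ b ^ 2 := by gcongr
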